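/- Suppose μ satisfies W₂I(C), i.e. W₂(ν,μ)² ≤ 4C² I(ν|μ) for all probability measures ν on ℝⁿ. Then for every bounded g ∈ C¹(ℝⁿ), ∫ e^{Q₁g/C} dμ ≤ e^{μ(g)/C}, where Q₁g(x) = inf_{y ∈ ℝⁿ} ( g(y) + |x−y|²/2 ) is the inf-convolution of g at time 1. -/

import Mathlib

open MeasureTheory ENNReal Classical

/-- A coupling of `ν` and `μ`. -/
def IsCoupling {n : ℕ}
    (π : Measure (EuclideanSpace ℝ (Fin n) × EuclideanSpace ℝ (Fin n)))
    (ν μ : Measure (EuclideanSpace ℝ (Fin n))) : Prop :=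
  π.map Prod.fst = ν ∧ π.map Prod.snd = μ

/-- The `L^p`-Wasserstein distance for the Euclidean distance. -/
noncomputable def wassersteinDist {n : ℕ} (p : ℝ)
    (ν μ : Measure (EuclideanSpace ℝ (Fin n))) : ℝ≥0∞ :=
  (⨅ (π : Measure (EuclideanSpace ℝ (Fin n) × EuclideanSpace ℝ (Fin n)))
      (_ : IsCoupling π ν μ), ∫⁻ q, edist q.1 q.2 ^ p ∂π) ^ (1 / p)

/-- The relative entropy (Kullback information) `H(ν|μ)`. -/
noncomputable def relEntropy {n : ℕ}
    (ν μ : Measure (EuclideanSpace ℝ (Fin n))) : ℝ≥0∞ :=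
  if ν ≪ μ ∧ Integrable (llr ν μ) ν then ENNReal.ofReal (∫ x, llr ν μ x ∂ν) else ⊤

/-- The Fisher information `I(ν|μ) = ∫ |∇√f|² dμ` for `ν = fμ` with `√f ∈ H¹(μ)`,
and `+∞` otherwise. -/
noncomputable def fisherInfo {n : ℕ}
    (ν μ : Measure (EuclideanSpace ℝ (Fin n))) : ℝ≥0∞ :=
  ⨅ (f : EuclideanSpace ℝ (Fin n) → ℝ) (_ : ∀ x, 0 ≤ f x)
    (_ : ν = μ.withDensity fun x => ENNReal.ofReal (f x))
    (_ : Differentiable ℝ fun x => Real.sqrt (f x)),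
    ∫⁻ x, (‖gradient (fun y => Real.sqrt (f y)) x‖₊ : ℝ≥0∞) ^ 2 ∂μ

open Filter Topology Set
open scoped NNReal

lemma Real.abs_exp_sub_exp_le_of_le {a b B : ℝ} (ha : a ≤ B) (hb : b ≤ B) :
    |Real.exp a - Real.exp b| ≤ Real.exp B * |a - b| := by
  wlog h : b ≤ a generalizing a b
  · rw [abs_sub_comm, abs_sub_comm a b]
    exact this hb ha (le_of_not_ge h)
  · rw [abs_of_nonneg (sub_nonneg.2 (Real.exp_le_exp.2 h)), abs_of_nonneg (sub_nonneg.2 h)]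
    have h1 := Real.add_one_le_exp (b - a)
    have h2 : Real.exp b = Real.exp a * Real.exp (b - a) := by
      rw [← Real.exp_add]; congr 1; ring
    calc Real.exp a - Real.exp b ≤ Real.exp a * (a - b) := by
          rw [h2]; nlinarith [Real.exp_pos a]
      _ ≤ Real.exp B * (a - b) :=
          mul_le_mul_of_nonneg_right (Real.exp_le_exp.2 ha) (sub_nonneg.2 h)

/-- The inf-convolution `Q_t g`, multiplied by `t`. -/
noncomputable def scaledInfConv {E : Type*} [NormedAddCommGroup E] (g : E → ℝ) (t : ℝ) (x : E) :
    ℝ :=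
  ⨅ y, (t * g y + ‖x - y‖ ^ 2 / 2)

namespace scaledInfConv

variable {E : Type*} [NormedAddCommGroup E] {g : E → ℝ} {M t s : ℝ}

lemma neg_le_integrand (hM : ∀ y, |g y| ≤ M) (ht : 0 ≤ t) (x y : E) :
    -(t * M) ≤ t * g y + ‖x - y‖ ^ 2 / 2 := by
  have := mul_le_mul_of_nonneg_left (abs_le.1 (hM y)).1 ht
  nlinarith [sq_nonneg ‖x - y‖]

lemma bddBelow_range (hM : ∀ y, |g y| ≤ M) (ht : 0 ≤ t) (x : E) :
    BddBelow (range fun y => t * g y + ‖x - y‖ ^ 2 / 2) :=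
  ⟨-(t * M), by rintro _ ⟨y, rfl⟩; exact neg_le_integrand hM ht x y⟩

lemma le_apply (hM : ∀ y, |g y| ≤ M) (ht : 0 ≤ t) (x y : E) :
    scaledInfConv g t x ≤ t * g y + ‖x - y‖ ^ 2 / 2 :=
  ciInf_le (bddBelow_range hM ht x) y

lemma abs_le_mul (hM : ∀ y, |g y| ≤ M) (ht : 0 ≤ t) (x : E) :
    |scaledInfConv g t x| ≤ t * M := by
  refine abs_le.2 ⟨le_ciInf fun y => neg_le_integrand hM ht x y, ?_⟩
  have h := le_apply hM ht x x
  have := mul_le_mul_of_nonneg_left (abs_le.1 (hM x)).2 ht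
  simp only [sub_self, norm_zero] at h
  linarith

lemma sub_le_mul_abs_sub (hM : ∀ y, |g y| ≤ M) (ht : 0 ≤ t) (x : E) :
    scaledInfConv g t x - M * |t - s| ≤ scaledInfConv g s x := by
  refine le_ciInf fun y => ?_
  have h1 := le_apply hM ht x y
  have h2 : (t - s) * g y ≤ M * |t - s| := by
    calc (t - s) * g y ≤ |(t - s) * g y| := le_abs_self _
      _ = |t - s| * |g y| := abs_mul _ _
      _ ≤ |t - s| * M := mul_le_mul_of_nonneg_left (hM y) (abs_nonneg _)
      _ = M * |t - s| := mul_comm _ _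
  nlinarith

lemma continuousOn_time (hM : ∀ y, |g y| ≤ M) (x : E) :
    ContinuousOn (fun t => scaledInfConv g t x) (Ici 0) := by
  have hM0 : 0 ≤ M := (abs_nonneg _).trans (hM x)
  have : LipschitzOnWith M.toNNReal (fun t => scaledInfConv g t x) (Ici 0) := by
    refine LipschitzOnWith.of_dist_le_mul fun t ht s hs => ?_
    rw [Real.dist_eq, Real.dist_eq, Real.coe_toNNReal _ hM0, abs_le]
    have h1 := sub_le_mul_abs_sub (s := s) hM ht x
    have h2 := sub_le_mul_abs_sub (s := t) hM hs x
    rw [abs_sub_comm] at h2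
    constructor <;> linarith
  exact this.continuousOn

lemma exists_lipschitzWith (hM : ∀ y, |g y| ≤ M) (ht : 0 ≤ t) :
    ∃ K, LipschitzWith K (scaledInfConv g t) := by
  have hM0 : 0 ≤ M := (abs_nonneg _).trans (hM 0)
  have hA : 0 ≤ t * M := mul_nonneg ht hM0
  refine ⟨(2 * (t * M) + 3).toNNReal, LipschitzWith.of_le_add_mul' _ fun x' x => ?_⟩
  rw [dist_eq_norm]
  obtain hd | hd := le_total 1 ‖x' - x‖
  · have h1 := abs_le.1 (abs_le_mul hM ht x)
    have h2 := abs_le.1 (abs_le_mul hM ht x')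
    nlinarith
  · refine le_of_forall_pos_le_add fun ε hε => ?_
    obtain ⟨y, hy⟩ := exists_lt_of_ciInf_lt
      (lt_add_of_pos_right (scaledInfConv g t x) (lt_min hε one_pos))
    have h1 := (abs_le.1 (abs_le_mul hM ht x)).2
    have h2 := mul_le_mul_of_nonneg_left (abs_le.1 (hM y)).1 ht
    have h3 := min_le_left ε 1
    have h4 := min_le_right ε 1
    have hr : ‖x - y‖ ≤ 2 * (t * M) + 2 := by
      refine le_of_sq_le_sq ?_ (by positivity)
      nlinarith
    have h5 := le_apply hM ht x' y
    have h6 : ‖x' - y‖ ≤ ‖x' - x‖ + ‖x - y‖ := norm_sub_le_norm_sub_add_norm_sub _ _ _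
    have h7 : ‖x' - y‖ ^ 2 ≤ (‖x' - x‖ + ‖x - y‖) ^ 2 := by gcongr
    nlinarith [norm_nonneg (x' - x), norm_nonneg (x - y)]

/-- The semigroup inequality `Q_{t+s} g ≤ Q_s (Q_t g)`. -/
lemma add_le (hM : ∀ y, |g y| ≤ M) (ht : 0 < t) (hs : 0 < s) (x y : E) :
    scaledInfConv g (t + s) x ≤
      (1 + s / t) * scaledInfConv g t y + (t + s) / (2 * s) * ‖x - y‖ ^ 2 := by
  have hst : 0 < 1 + s / t := by positivity
  have : (scaledInfConv g (t + s) x - (t + s) / (2 * s) * ‖x - y‖ ^ 2) / (1 + s / t) ≤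
      scaledInfConv g t y := by
    refine le_ciInf fun z => ?_
    rw [div_le_iff₀ hst]
    have h1 := le_apply hM (add_pos ht hs).le x z
    have h2 : ‖x - z‖ ^ 2 ≤ (‖x - y‖ + ‖y - z‖) ^ 2 := by
      gcongr; exact norm_sub_le_norm_sub_add_norm_sub _ _ _
    have h3 : (‖x - y‖ + ‖y - z‖) ^ 2 ≤
        (t + s) / s * ‖x - y‖ ^ 2 + (1 + s / t) * ‖y - z‖ ^ 2 := by
      have : (t + s) / s * ‖x - y‖ ^ 2 + (1 + s / t) * ‖y - z‖ ^ 2 -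
          (‖x - y‖ + ‖y - z‖) ^ 2 = (t * ‖x - y‖ - s * ‖y - z‖) ^ 2 / (s * t) := by
        field_simp; ring
      have h : 0 ≤ (t * ‖x - y‖ - s * ‖y - z‖) ^ 2 / (s * t) := by positivity
      linarith
    have h4 : (t * g z + ‖y - z‖ ^ 2 / 2) * (1 + s / t) =
        (t + s) * g z + (1 + s / t) * ‖y - z‖ ^ 2 / 2 := by field_simp
    have h5 : (t + s) / (2 * s) * ‖x - y‖ ^ 2 = (t + s) / s * ‖x - y‖ ^ 2 / 2 := by field_simp
    linarith
  rw [div_le_iff₀ hst] at this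
  linarith

end scaledInfConv

section Mollification

variable {E : Type*} [NormedAddCommGroup E] [InnerProductSpace ℝ E] [FiniteDimensional ℝ E]
  [MeasurableSpace E] [BorelSpace E] (m : Measure E) [m.IsAddHaarMeasure]

lemma ContDiffBump.norm_integral_normed_smul_le {F : Type*} [NormedAddCommGroup F]
    [NormedSpace ℝ F] (φ : ContDiffBump (0 : E)) {u : E → F} {B : ℝ} (hu : ∀ z, ‖u z‖ ≤ B) :
    ‖∫ z, φ.normed m z • u z ∂m‖ ≤ B := by
  have h : ‖∫ z, φ.normed m z • u z ∂m‖ ≤ ∫ z, φ.normed m z * B ∂m := by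
    refine norm_integral_le_of_norm_le (φ.integrable_normed.mul_const B)
      (Eventually.of_forall fun z => ?_)
    rw [norm_smul, Real.norm_of_nonneg (φ.nonneg_normed z)]
    exact mul_le_mul_of_nonneg_left (hu z) (φ.nonneg_normed z)
  rwa [integral_mul_const, φ.integral_normed, one_mul] at h

lemma LipschitzWith.hasFDerivAt_normed_convolution {f : E → ℝ} {K : ℝ≥0} {B : ℝ}
    (hf : LipschitzWith K f) (hB : ∀ x, |f x| ≤ B) (φ : ContDiffBump (0 : E)) (x : E) :
    HasFDerivAt (fun x => ∫ z, φ.normed m z • f (x - z) ∂m)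
      (∫ z, φ.normed m z • fderiv ℝ f (x - z) ∂m) x := by
  have hmeas : ∀ x, AEStronglyMeasurable (fun z => φ.normed m z • f (x - z)) m := fun x =>
    (φ.continuous_normed.smul
      (hf.continuous.comp (continuous_const.sub continuous_id))).aestronglyMeasurable
  refine (hasFDerivAt_integral_of_dominated_loc_of_lip (s := univ)
    (bound := fun z => φ.normed m z * K) univ_mem (Eventually.of_forall hmeas) ?_ ?_ ?_
    (φ.integrable_normed.mul_const _) ?_).2
  · refine (φ.integrable_normed.mul_const B).mono' (hmeas x) (Eventually.of_forall fun z => ?_)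
    rw [norm_smul, Real.norm_of_nonneg (φ.nonneg_normed z)]
    exact mul_le_mul_of_nonneg_left (hB _) (φ.nonneg_normed z)
  · exact φ.continuous_normed.aestronglyMeasurable.smul
      ((measurable_fderiv ℝ f).comp (measurable_const.sub measurable_id)).aestronglyMeasurable
  · refine Eventually.of_forall fun z => LipschitzOnWith.of_dist_le_mul fun a _ b _ => ?_
    have h0 := φ.nonneg_normed (μ := m) z
    have h1 := hf.dist_le_mul (a - z) (b - z)
    rw [dist_sub_right] at h1
    rw [Real.coe_nnabs, abs_of_nonneg (by positivity), dist_smul₀, Real.norm_of_nonneg h0,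
      mul_assoc]
    exact mul_le_mul_of_nonneg_left h1 h0
  · have h := (quasiMeasurePreserving_sub_left m x).ae (hf.ae_differentiableAt (μ := m))
    filter_upwards [h] with z hz
    exact ((hasFDerivAt_comp_sub z).2 hz.hasFDerivAt).const_smul (φ.normed m z)

lemma LipschitzWith.exists_differentiable_approx {f : E → ℝ} {K : ℝ≥0} {B : ℝ}
    (hf : LipschitzWith K f) (hB : ∀ x, |f x| ≤ B) :
    ∃ F : ℕ → E → ℝ, (∀ k, Differentiable ℝ (F k)) ∧ (∀ k x, |F k x| ≤ B) ∧
      (∀ k x, ‖fderiv ℝ (F k) x‖ ≤ K) ∧ (∀ x, Tendsto (fun k => F k x) atTop (𝓝 (f x))) ∧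
      ∀ᵐ x ∂m, Tendsto (fun k => fderiv ℝ (F k) x) atTop (𝓝 (fderiv ℝ f x)) := by
  let φ : ℕ → ContDiffBump (0 : E) := fun k =>
    ⟨1 / ((k : ℝ) + 1) / 2, 1 / ((k : ℝ) + 1), by positivity, half_lt_self (by positivity)⟩
  have hφ : Tendsto (fun k => (φ k).rOut) atTop (𝓝 0) := tendsto_one_div_add_atTop_nhds_zero_nat
  have hD := fun k x => hf.hasFDerivAt_normed_convolution m hB (φ k) x
  refine ⟨fun k x => ∫ z, (φ k).normed m z • f (x - z) ∂m,
    fun k x => (hD k x).differentiableAt,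
    fun k x => Real.norm_eq_abs _ ▸ (φ k).norm_integral_normed_smul_le m fun z => hB (x - z),
    fun k x => ?_,
    fun x => ContDiffBump.convolution_tendsto_right_of_continuous hφ hf.continuous x, ?_⟩
  · rw [(hD k x).fderiv]
    exact (φ k).norm_integral_normed_smul_le m fun z => norm_fderiv_le_of_lipschitz ℝ hf
  · have hloc : LocallyIntegrable (fderiv ℝ f) m := by
      refine (locallyIntegrable_const (K : ℝ)).mono
        (measurable_fderiv ℝ f).aestronglyMeasurable (Eventually.of_forall fun x => ?_)
      rw [Real.norm_of_nonneg K.coe_nonneg]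
      exact norm_fderiv_le_of_lipschitz ℝ hf
    have h := ContDiffBump.ae_convolution_tendsto_right_of_locallyIntegrable (K := 2) hφ
      (Eventually.of_forall fun k => le_of_eq (mul_div_cancel₀ _ two_ne_zero).symm) hloc
    filter_upwards [h] with x hx
    simp_rw [(hD _ x).fderiv]
    exact hx

end Mollification

lemma Continuous.integrable_of_abs_le {X : Type*} [TopologicalSpace X] [MeasurableSpace X]
    [OpensMeasurableSpace X] {μ : Measure X} [IsFiniteMeasure μ] {f : X → ℝ} {B : ℝ}
    (hf : Continuous f) (hB : ∀ x, |f x| ≤ B) : Integrable f μ :=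
  Integrable.of_bound hf.aestronglyMeasurable B (Eventually.of_forall hB)

section Transport

variable {n : ℕ} {μ ν : Measure (EuclideanSpace ℝ (Fin n))} {w φ : EuclideanSpace ℝ (Fin n) → ℝ}
  {B C : ℝ}

/-- The easy half of Kantorovich duality for the quadratic cost. -/
lemma ofReal_integral_sub_le_wassersteinDist_sq [IsProbabilityMeasure ν]
    (hwc : Continuous w) (hφc : Continuous φ) (hw : ∀ x, |w x| ≤ B) (hφ : ∀ x, |φ x| ≤ B)
    (hwφ : ∀ x y, w x ≤ φ y + ‖x - y‖ ^ 2 / 2) :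
    ENNReal.ofReal (2 * (∫ x, w x ∂ν - ∫ x, φ x ∂μ)) ≤ wassersteinDist 2 ν μ ^ 2 := by
  have h2 : wassersteinDist 2 ν μ ^ 2 =
      ⨅ (π : Measure (EuclideanSpace ℝ (Fin n) × EuclideanSpace ℝ (Fin n)))
        (_ : IsCoupling π ν μ), ∫⁻ q, edist q.1 q.2 ^ (2 : ℝ) ∂π := by
    rw [wassersteinDist, ← ENNReal.rpow_natCast, ← ENNReal.rpow_mul]
    norm_num
  rw [h2]
  refine le_iInf₂ fun π hπ => ?_
  have : IsProbabilityMeasure π := ⟨by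
    have h := measure_univ (μ := ν)
    rwa [← hπ.1, Measure.map_apply measurable_fst MeasurableSet.univ, preimage_univ] at h⟩
  have hi1 : Integrable (fun q : EuclideanSpace ℝ (Fin n) × EuclideanSpace ℝ (Fin n) => w q.1) π :=
    (hwc.comp continuous_fst).integrable_of_abs_le fun q => hw q.1
  have hi2 : Integrable (fun q : EuclideanSpace ℝ (Fin n) × EuclideanSpace ℝ (Fin n) => φ q.2) π :=
    (hφc.comp continuous_snd).integrable_of_abs_le fun q => hφ q.2
  have hi := (hi1.sub hi2).const_mul 2
  have h3 : 2 * (∫ x, w x ∂ν - ∫ x, φ x ∂μ) = ∫ q, 2 * (w q.1 - φ q.2) ∂π := by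
    rw [integral_const_mul, integral_sub hi1 hi2, ← hπ.1, ← hπ.2,
      integral_map measurable_fst.aemeasurable hwc.aestronglyMeasurable,
      integral_map measurable_snd.aemeasurable hφc.aestronglyMeasurable]
  calc ENNReal.ofReal (2 * (∫ x, w x ∂ν - ∫ x, φ x ∂μ))
      ≤ ENNReal.ofReal (∫ q, max (2 * (w q.1 - φ q.2)) 0 ∂π) := by
        rw [h3]
        exact ENNReal.ofReal_le_ofReal (integral_mono hi hi.pos_part fun q => le_max_left _ _)
    _ = ∫⁻ q, ENNReal.ofReal (max (2 * (w q.1 - φ q.2)) 0) ∂π :=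
        ofReal_integral_eq_lintegral_ofReal hi.pos_part
          (Eventually.of_forall fun q => le_max_right _ _)
    _ ≤ ∫⁻ q, edist q.1 q.2 ^ (2 : ℝ) ∂π := by
        refine lintegral_mono fun q => ?_
        rw [edist_dist, ENNReal.ofReal_rpow_of_nonneg dist_nonneg zero_le_two, dist_eq_norm,
          Real.rpow_two]
        have := hwφ q.1 q.2
        exact ENNReal.ofReal_le_ofReal (max_le (by linarith) (by positivity))

lemma integrable_exp_and_integral_exp_pos [IsProbabilityMeasure μ]
    {h : EuclideanSpace ℝ (Fin n) → ℝ} (hc : Continuous h) (hB : ∀ x, |h x| ≤ B) :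
    Integrable (fun x => Real.exp (h x)) μ ∧ 0 < ∫ x, Real.exp (h x) ∂μ := by
  have hi : Integrable (fun x => Real.exp (h x)) μ :=
    hc.rexp.integrable_of_abs_le (B := Real.exp B) fun x => by
      rw [Real.abs_exp]; exact Real.exp_le_exp.2 (abs_le.1 (hB x)).2
  exact ⟨hi, integral_exp_pos hi⟩

/-- `W₂I(C)` tested against a probability measure with density proportional to `exp h`,
with `h` differentiable, in dual form. -/
lemma W2I_dual_of_differentiable [IsProbabilityMeasure μ]
    (hW2I : ∀ ν : Measure (EuclideanSpace ℝ (Fin n)), IsProbabilityMeasure ν →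
      wassersteinDist 2 ν μ ^ 2 ≤ ENNReal.ofReal (4 * C ^ 2) * fisherInfo ν μ)
    (hwc : Continuous w) (hφc : Continuous φ) (hw : ∀ x, |w x| ≤ B) (hφ : ∀ x, |φ x| ≤ B)
    (hwφ : ∀ x y, w x ≤ φ y + ‖x - y‖ ^ 2 / 2)
    {h : EuclideanSpace ℝ (Fin n) → ℝ} {A K : ℝ} (hd : Differentiable ℝ h)
    (hA : ∀ x, |h x| ≤ A) (hK : ∀ x, ‖fderiv ℝ h x‖ ≤ K) :
    ∫ x, Real.exp (h x) * w x ∂μ - (∫ x, Real.exp (h x) ∂μ) * ∫ x, φ x ∂μ ≤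
      C ^ 2 / 2 * ∫ x, Real.exp (h x) * ‖fderiv ℝ h x‖ ^ 2 ∂μ := by
  obtain ⟨hi, hpos⟩ := integrable_exp_and_integral_exp_pos (μ := μ) hd.continuous hA
  set Z := ∫ x, Real.exp (h x) ∂μ with hZ
  set f : EuclideanSpace ℝ (Fin n) → ℝ := fun x => Real.exp (h x) / Z with hf
  have hf0 : ∀ x, 0 ≤ f x := fun x => by positivity
  have hfc : Continuous f := hd.continuous.rexp.div_const Z
  set ν := μ.withDensity fun x => ENNReal.ofReal (f x) with hν
  have hνp : IsProbabilityMeasure ν := ⟨by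
    rw [hν, withDensity_apply _ MeasurableSet.univ, setLIntegral_univ,
      ← ofReal_integral_eq_lintegral_ofReal (hi.div_const Z) (Eventually.of_forall hf0),
      integral_div, ← hZ, div_self hpos.ne', ENNReal.ofReal_one]⟩
  have hsqrt : (fun x => Real.sqrt (f x)) = fun x => Real.exp (h x / 2) / Real.sqrt Z := by
    funext x
    rw [hf, Real.sqrt_div (Real.exp_pos _).le, Real.exp_half]
  have hder : ∀ x, HasFDerivAt (fun x => Real.sqrt (f x))
      ((Real.exp (h x / 2) / Real.sqrt Z / 2) • fderiv ℝ h x) x := fun x => by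
    rw [hsqrt]
    have h1 := ((hd x).hasFDerivAt.mul_const (2⁻¹ : ℝ)).exp.mul_const (Real.sqrt Z)⁻¹
    simp only [← div_eq_mul_inv] at h1
    refine h1.congr_fderiv ?_
    rw [smul_smul, smul_smul]
    congr 1
    ring
  have hgrad : ∀ x, (‖gradient (fun y => Real.sqrt (f y)) x‖₊ : ℝ≥0∞) ^ 2 =
      ENNReal.ofReal (1 / 4 * (f x * ‖fderiv ℝ h x‖ ^ 2)) := fun x => by
    have h1 : ‖gradient (fun y => Real.sqrt (f y)) x‖ =
        Real.exp (h x / 2) / Real.sqrt Z / 2 * ‖fderiv ℝ h x‖ := by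
      rw [gradient, LinearIsometryEquiv.norm_map, (hder x).fderiv, norm_smul,
        Real.norm_of_nonneg (by positivity)]
    rw [← enorm_eq_nnnorm, ← ofReal_norm, ← ENNReal.ofReal_pow (norm_nonneg _), h1]
    congr 1
    have h2 : (Real.exp (h x / 2) / Real.sqrt Z) ^ 2 = f x := by
      rw [← congrFun hsqrt x, Real.sq_sqrt (hf0 x)]
    rw [← h2]; ring
  have hgi : Integrable (fun x => Real.exp (h x) * ‖fderiv ℝ h x‖ ^ 2) μ := by
    refine hi.mul_bdd (c := K ^ 2)
      (((measurable_fderiv ℝ h).norm.pow_const 2).aestronglyMeasurable)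
      (Eventually.of_forall fun x => ?_)
    rw [Real.norm_of_nonneg (by positivity)]
    exact pow_le_pow_left₀ (norm_nonneg _) (hK x) 2
  have hfisher : fisherInfo ν μ ≤
      ENNReal.ofReal (1 / 4 * (∫ x, Real.exp (h x) * ‖fderiv ℝ h x‖ ^ 2 ∂μ) / Z) := by
    refine (iInf₂_le_of_le f hf0 (iInf₂_le_of_le hν
      (fun x => (hder x).differentiableAt) le_rfl)).trans_eq ?_
    have h1 : (fun x => 1 / 4 * (f x * ‖fderiv ℝ h x‖ ^ 2)) =
        fun x => 1 / 4 / Z * (Real.exp (h x) * ‖fderiv ℝ h x‖ ^ 2) := by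
      funext x; rw [hf]; ring
    simp_rw [hgrad]
    rw [← ofReal_integral_eq_lintegral_ofReal (by rw [h1]; exact hgi.const_mul _)
      (Eventually.of_forall fun x => mul_nonneg (by norm_num) (mul_nonneg (hf0 x) (by positivity))),
      h1, integral_const_mul]
    congr 1; ring
  have hmain := (ofReal_integral_sub_le_wassersteinDist_sq (μ := μ) (ν := ν)
    hwc hφc hw hφ hwφ).trans ((hW2I ν hνp).trans (mul_le_mul_right hfisher _))
  have hI : 0 ≤ ∫ x, Real.exp (h x) * ‖fderiv ℝ h x‖ ^ 2 ∂μ :=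
    integral_nonneg fun x => by positivity
  rw [← ENNReal.ofReal_mul (by positivity), ENNReal.ofReal_le_ofReal_iff (by positivity)] at hmain
  have hνw : ∫ x, w x ∂ν = (∫ x, Real.exp (h x) * w x ∂μ) / Z := by
    rw [hν, integral_withDensity_eq_integral_toReal_smul
      hfc.measurable.ennreal_ofReal
      (Eventually.of_forall fun x => ENNReal.ofReal_lt_top), ← integral_div]
    refine integral_congr_ae (Eventually.of_forall fun x => ?_)
    change (ENNReal.ofReal (f x)).toReal * w x = _
    rw [ENNReal.toReal_ofReal (hf0 x), hf]
    ring
  rw [hνw] at hmain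
  have h5 := mul_le_mul_of_nonneg_right hmain hpos.le
  field_simp at h5
  linarith

/-- `W₂I(C)` tested against a probability measure with density proportional to `exp h`,
with `h` bounded and Lipschitz, in dual form. -/
lemma W2I_dual_of_lipschitzWith [IsProbabilityMeasure μ] (hμ : μ ≪ volume)
    (hW2I : ∀ ν : Measure (EuclideanSpace ℝ (Fin n)), IsProbabilityMeasure ν →
      wassersteinDist 2 ν μ ^ 2 ≤ ENNReal.ofReal (4 * C ^ 2) * fisherInfo ν μ)
    (hwc : Continuous w) (hφc : Continuous φ) (hw : ∀ x, |w x| ≤ B) (hφ : ∀ x, |φ x| ≤ B)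
    (hwφ : ∀ x y, w x ≤ φ y + ‖x - y‖ ^ 2 / 2)
    {h : EuclideanSpace ℝ (Fin n) → ℝ} {A : ℝ} {K : ℝ≥0} (hlip : LipschitzWith K h)
    (hA : ∀ x, |h x| ≤ A) :
    ∫ x, Real.exp (h x) * w x ∂μ - (∫ x, Real.exp (h x) ∂μ) * ∫ x, φ x ∂μ ≤
      C ^ 2 / 2 * ∫ x, Real.exp (h x) * ‖fderiv ℝ h x‖ ^ 2 ∂μ := by
  obtain ⟨F, hFd, hFA, hFK, hF, hF'⟩ := hlip.exists_differentiable_approx volume hA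
  have hexp : ∀ k x, ‖Real.exp (F k x)‖ ≤ Real.exp A := fun k x => by
    rw [Real.norm_eq_abs, Real.abs_exp]
    exact Real.exp_le_exp.2 (abs_le.1 (hFA k x)).2
  have hlim : ∀ x, Tendsto (fun k => Real.exp (F k x)) atTop (𝓝 (Real.exp (h x))) := fun x =>
    (Real.continuous_exp.tendsto _).comp (hF x)
  have t1 : Tendsto (fun k => ∫ x, Real.exp (F k x) * w x ∂μ) atTop
      (𝓝 (∫ x, Real.exp (h x) * w x ∂μ)) := by
    refine tendsto_integral_of_dominated_convergence (fun _ => Real.exp A * B)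
      (fun k => ((hFd k).continuous.rexp.mul hwc).aestronglyMeasurable) (integrable_const _)
      (fun k => Eventually.of_forall fun x => ?_)
      (Eventually.of_forall fun x => (hlim x).mul_const _)
    rw [norm_mul]
    exact mul_le_mul (hexp k x) (hw x) (norm_nonneg _) (Real.exp_pos _).le
  have t2 : Tendsto (fun k => ∫ x, Real.exp (F k x) ∂μ) atTop
      (𝓝 (∫ x, Real.exp (h x) ∂μ)) :=
    tendsto_integral_of_dominated_convergence (fun _ => Real.exp A)
      (fun k => (hFd k).continuous.rexp.aestronglyMeasurable) (integrable_const _)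
      (fun k => Eventually.of_forall (hexp k)) (Eventually.of_forall hlim)
  have t3 : Tendsto (fun k => ∫ x, Real.exp (F k x) * ‖fderiv ℝ (F k) x‖ ^ 2 ∂μ) atTop
      (𝓝 (∫ x, Real.exp (h x) * ‖fderiv ℝ h x‖ ^ 2 ∂μ)) := by
    refine tendsto_integral_of_dominated_convergence (fun _ => Real.exp A * (K : ℝ) ^ 2)
      (fun k => (hFd k).continuous.rexp.aestronglyMeasurable.mul
        ((measurable_fderiv ℝ (F k)).norm.pow_const 2).aestronglyMeasurable) (integrable_const _)
      (fun k => Eventually.of_forall fun x => ?_) ?_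
    · rw [norm_mul, norm_pow, norm_norm]
      exact mul_le_mul (hexp k x) (pow_le_pow_left₀ (norm_nonneg _) (hFK k x) 2)
        (by positivity) (Real.exp_pos _).le
    · filter_upwards [hμ.ae_le hF'] with x hx
      exact (hlim x).mul (hx.norm.pow 2)
  exact le_of_tendsto_of_tendsto' (t1.sub (t2.mul_const _)) (t3.const_mul _) fun k =>
    W2I_dual_of_differentiable hW2I hwc hφc hw hφ hwφ (hFd k) (hFA k) (hFK k)

end Transport

section Evolution

variable {n : ℕ} {μ : Measure (EuclideanSpace ℝ (Fin n))} {g : EuclideanSpace ℝ (Fin n) → ℝ}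
  {M C t : ℝ}

/-- A majorant of the right difference quotients in time of `exp (scaledInfConv g · x / C)`,
obtained by moving from `x` against the spatial gradient. -/
lemma exists_slope_majorant [IsProbabilityMeasure μ] (hμ : μ ≪ volume) (hC : 0 < C)
    (hM : ∀ y, |g y| ≤ M) (ht : 0 < t) :
    ∃ b : ℝ → EuclideanSpace ℝ (Fin n) → ℝ,
      (∀ s ∈ Ioc (0 : ℝ) 1, Integrable (b s) μ ∧ ∀ x,
        s⁻¹ * (Real.exp (scaledInfConv g (t + s) x / C) - Real.exp (scaledInfConv g t x / C))
          ≤ b s x) ∧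
      Tendsto (fun s => ∫ x, b s x ∂μ) (𝓝[>] 0)
        (𝓝 (∫ x, Real.exp (scaledInfConv g t x / C) *
          ((scaledInfConv g t x - ‖fderiv ℝ (scaledInfConv g t) x‖ ^ 2 / 2) / (t * C)) ∂μ)) := by
  obtain ⟨K, hK⟩ := scaledInfConv.exists_lipschitzWith hM ht.le
  have hM0 : 0 ≤ M := (abs_nonneg _).trans (hM 0)
  set w := scaledInfConv g t with hw
  have hwM : ∀ x, |w x| ≤ t * M := scaledInfConv.abs_le_mul hM ht.le
  set p := gradient w
  have hpm : Measurable p :=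
    (InnerProductSpace.toDual ℝ (EuclideanSpace ℝ (Fin n))).symm.continuous.measurable.comp
      (measurable_fderiv ℝ w)
  have hpn : ∀ x, ‖p x‖ = ‖fderiv ℝ w x‖ := fun x => LinearIsometryEquiv.norm_map _ _
  have hpK : ∀ x, ‖p x‖ ≤ K := fun x => hpn x ▸ norm_fderiv_le_of_lipschitz ℝ hK
  set e : ℝ → EuclideanSpace ℝ (Fin n) → ℝ := fun s x =>
    ((1 + s / t) * w (x - (s / t) • p x) + (t + s) * s * ‖p x‖ ^ 2 / (2 * t ^ 2)) / C with he
  have he0 : ∀ x, e 0 x = w x / C := fun x => by simp [he]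
  have hem : ∀ s, Measurable (e s) := fun s => by
    have h1 : Measurable fun x => w (x - (s / t) • p x) :=
      hK.continuous.measurable.comp (measurable_id.sub (hpm.const_smul (s / t)))
    exact ((h1.const_mul _).add (((hpm.norm.pow_const 2).const_mul _).div_const _)).div_const _
  set c : ℝ := (M + (1 + 1 / t) * (K * (K / t)) + (t + 1) * K ^ 2 / (2 * t ^ 2)) / C with hc
  have hc0 : 0 ≤ c := by positivity
  have heb : ∀ s ∈ Ioc (0 : ℝ) 1, ∀ x, |e s x - w x / C| ≤ c * s := fun s hs x => by
    obtain ⟨hs0, hs1⟩ := hs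
    have h1 : |w (x - (s / t) • p x) - w x| ≤ K * (K / t) * s := by
      have h := hK.dist_le_mul (x - (s / t) • p x) x
      rw [Real.dist_eq, dist_eq_norm, sub_sub_cancel_left, norm_neg, norm_smul,
        Real.norm_of_nonneg (by positivity)] at h
      refine h.trans ?_
      calc (K : ℝ) * (s / t * ‖p x‖) ≤ K * (s / t * K) := by gcongr; exact hpK x
        _ = K * (K / t) * s := by ring
    have h2 : e s x - w x / C = ((1 + s / t) * (w (x - (s / t) • p x) - w x) + s / t * w x
        + (t + s) * s * ‖p x‖ ^ 2 / (2 * t ^ 2)) / C := by rw [he]; ring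
    rw [h2, abs_div, abs_of_pos hC, hc, div_mul_eq_mul_div _ C s]
    refine div_le_div_of_nonneg_right ?_ hC.le
    refine (abs_add_le _ _).trans ?_
    have h3 : |(1 + s / t) * (w (x - (s / t) • p x) - w x)| ≤
        (1 + 1 / t) * (K * (K / t) * s) := by
      rw [abs_mul, abs_of_pos (by positivity)]
      gcongr
    have h4 : |s / t * w x| ≤ M * s := by
      rw [abs_mul, abs_of_pos (by positivity)]
      calc s / t * |w x| ≤ s / t * (t * M) := by gcongr; exact hwM x
        _ = M * s := by field_simp
    have h5 : |(t + s) * s * ‖p x‖ ^ 2 / (2 * t ^ 2)| ≤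
        (t + 1) * s * K ^ 2 / (2 * t ^ 2) := by
      rw [abs_of_nonneg (by positivity)]
      gcongr
      exact hpK x
    have h6 := abs_add_le ((1 + s / t) * (w (x - (s / t) • p x) - w x)) (s / t * w x)
    calc _ ≤ (1 + 1 / t) * (K * (K / t) * s) + M * s + (t + 1) * s * K ^ 2 / (2 * t ^ 2) := by
          linarith
      _ = _ := by ring
  set b : ℝ → EuclideanSpace ℝ (Fin n) → ℝ := fun s x =>
    s⁻¹ * (Real.exp (e s x) - Real.exp (w x / C)) with hb
  have hbm : ∀ s, AEStronglyMeasurable (b s) μ := fun s =>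
    (((hem s).exp.sub (hK.continuous.measurable.div_const C).exp).const_mul
      s⁻¹).aestronglyMeasurable
  have hbb : ∀ s ∈ Ioc (0 : ℝ) 1, ∀ x, ‖b s x‖ ≤ Real.exp (t * M / C + c) * c :=
    fun s hs x => by
      have h1 := heb s hs x
      have h2 : w x / C ≤ t * M / C := div_le_div_of_nonneg_right (abs_le.1 (hwM x)).2 hC.le
      have h3 : e s x ≤ t * M / C + c := by nlinarith [(abs_le.1 h1).2, hs.2]
      have h4 := Real.abs_exp_sub_exp_le_of_le h3 (h2.trans (le_add_of_nonneg_right hc0))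
      rw [hb, norm_mul, norm_inv, Real.norm_of_nonneg hs.1.le, Real.norm_eq_abs,
        inv_mul_le_iff₀ hs.1]
      calc _ ≤ Real.exp (t * M / C + c) * |e s x - w x / C| := h4
        _ ≤ Real.exp (t * M / C + c) * (c * s) := by gcongr
        _ = _ := by ring
  refine ⟨b, fun s hs => ⟨Integrable.of_bound (hbm s) _ (Eventually.of_forall (hbb s hs)),
    fun x => ?_⟩, ?_⟩
  · have hs0 := hs.1
    rw [hb]
    refine mul_le_mul_of_nonneg_left (sub_le_sub_right (Real.exp_le_exp.2 ?_) _)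
      (inv_nonneg.2 hs.1.le)
    refine div_le_div_of_nonneg_right ?_ hC.le
    refine (scaledInfConv.add_le hM ht hs.1 x (x - (s / t) • p x)).trans_eq ?_
    rw [← hw, _root_.sub_sub_cancel, norm_smul, Real.norm_of_nonneg (by positivity)]
    field_simp
  · have hev : ∀ᶠ s : ℝ in 𝓝[>] 0, s ∈ Ioc (0 : ℝ) 1 := Ioc_mem_nhdsGT one_pos
    refine tendsto_integral_filter_of_dominated_convergence
      (fun _ => Real.exp (t * M / C + c) * c) (Eventually.of_forall hbm)
      (hev.mono fun s hs => Eventually.of_forall (hbb s hs)) (integrable_const _) ?_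
    filter_upwards [hμ.ae_le (hK.ae_differentiableAt (μ := volume))] with x hx
    have h1 : HasDerivAt (fun s : ℝ => x - (s / t) • p x) (-((1 / t) • p x)) 0 :=
      (((hasDerivAt_id (0 : ℝ)).div_const t).smul_const (p x)).const_sub x
    have h2 : HasDerivAt (fun s : ℝ => w (x - (s / t) • p x)) (-(‖p x‖ ^ 2 / t)) 0 := by
      have h0 : HasFDerivAt w (fderiv ℝ w x) (x - ((0 : ℝ) / t) • p x) := by
        simpa using hx.hasFDerivAt
      refine (h0.comp_hasDerivAt (0 : ℝ) h1).congr_deriv ?_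
      rw [map_neg, map_smul, ← toDual_gradient, InnerProductSpace.toDual_apply_apply,
        real_inner_self_eq_norm_sq, smul_eq_mul]
      ring
    have h3 : HasDerivAt (fun s : ℝ => 1 + s / t) (1 / t) 0 :=
      ((hasDerivAt_id (0 : ℝ)).div_const t).const_add 1
    have h4 : HasDerivAt (fun s : ℝ => (t + s) * s * ‖p x‖ ^ 2 / (2 * t ^ 2))
        (‖p x‖ ^ 2 / (2 * t)) 0 := by
      have h := ((((hasDerivAt_id (0 : ℝ)).const_add t).mul (hasDerivAt_id (0 : ℝ))).mul_const
        (‖p x‖ ^ 2)).div_const (2 * t ^ 2)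
      refine h.congr_deriv ?_
      simp only [id]
      field_simp
      ring
    have h5 : HasDerivAt (fun s => Real.exp (e s x))
        (Real.exp (w x / C) * ((w x - ‖fderiv ℝ w x‖ ^ 2 / 2) / (t * C))) 0 := by
      refine (((h3.mul h2).add h4).div_const C).exp.congr_deriv ?_
      rw [← hpn]
      simp only [Pi.add_apply, Pi.mul_apply, zero_div, zero_smul, sub_zero, add_zero, mul_zero,
        zero_mul, one_mul]
      field_simp
      ring
    refine ((hasDerivAt_iff_tendsto_slope.1 h5).mono_left
      (nhdsWithin_mono 0 fun s (hs : 0 < s) => hs.ne')).congr fun s => ?_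
    simp only [slope, hb, vsub_eq_sub, smul_eq_mul, he0, sub_zero]

/-- The right upper Dini derivative of `t ↦ ∫ exp (scaledInfConv g t / C) ∂μ`. -/
lemma eventually_slope_integral_exp_lt [IsProbabilityMeasure μ] (hμ : μ ≪ volume) (hC : 0 < C)
    (hW2I : ∀ ν : Measure (EuclideanSpace ℝ (Fin n)), IsProbabilityMeasure ν →
      wassersteinDist 2 ν μ ^ 2 ≤ ENNReal.ofReal (4 * C ^ 2) * fisherInfo ν μ)
    (hg : Continuous g) (hM : ∀ y, |g y| ≤ M) (ht : 0 < t) {r : ℝ}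
    (hr : (∫ y, g y ∂μ) / C * ∫ x, Real.exp (scaledInfConv g t x / C) ∂μ < r) :
    ∀ᶠ z in 𝓝[>] t, (z - t)⁻¹ * (∫ x, Real.exp (scaledInfConv g z x / C) ∂μ -
      ∫ x, Real.exp (scaledInfConv g t x / C) ∂μ) < r := by
  obtain ⟨b, hb, hlim⟩ := exists_slope_majorant hμ hC hM ht
  obtain ⟨K, hK⟩ := scaledInfConv.exists_lipschitzWith hM ht.le
  have hint : ∀ s, 0 < s → Integrable (fun x => Real.exp (scaledInfConv g s x / C)) μ := by
    intro s hs
    obtain ⟨K, hK⟩ := scaledInfConv.exists_lipschitzWith hM hs.le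
    refine (integrable_exp_and_integral_exp_pos (B := s * M / C)
      (hK.continuous.div_const C) fun x => ?_).1
    rw [abs_div, abs_of_pos hC]
    exact div_le_div_of_nonneg_right (scaledInfConv.abs_le_mul hM hs.le x) hC.le
  set w := scaledInfConv g t with hw
  have hwM : ∀ x, |w x| ≤ t * M := scaledInfConv.abs_le_mul hM ht.le
  have hdual := W2I_dual_of_lipschitzWith (φ := fun y => t * g y) (h := fun x => C⁻¹ * w x)
    (K := C.toNNReal⁻¹ * K) (A := C⁻¹ * (t * M)) hμ hW2I hK.continuous
    (hg.const_mul t) hwM (fun x => by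
      rw [abs_mul, abs_of_pos ht]; exact mul_le_mul_of_nonneg_left (hM x) ht.le)
    (scaledInfConv.le_apply hM ht.le)
    (LipschitzWith.of_dist_le_mul fun x y => by
      rw [Real.dist_eq, ← mul_sub, abs_mul, abs_of_pos (inv_pos.2 hC), NNReal.coe_mul,
        NNReal.coe_inv, Real.coe_toNNReal _ hC.le, mul_assoc]
      exact mul_le_mul_of_nonneg_left (hK.dist_le_mul x y) (inv_pos.2 hC).le)
    (fun x => by
      rw [abs_mul, abs_of_pos (inv_pos.2 hC)]
      exact mul_le_mul_of_nonneg_left (hwM x) (inv_pos.2 hC).le)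
  have hfd : ∀ x, fderiv ℝ (fun x => C⁻¹ * w x) x = C⁻¹ • fderiv ℝ w x := fun x =>
    congrFun (fderiv_const_smul_field (f := w) C⁻¹) x
  have hexp : ∀ x, C⁻¹ * w x = w x / C := fun x => (div_eq_inv_mul _ _).symm
  simp_rw [hfd, norm_smul, mul_pow, Real.norm_of_nonneg (inv_pos.2 hC).le, hexp,
    integral_const_mul] at hdual
  have hi1 : Integrable (fun x => Real.exp (w x / C) * w x) μ :=
    (hint t ht).mul_bdd (c := t * M) hK.continuous.aestronglyMeasurable
      (Eventually.of_forall hwM)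
  have hi2 : Integrable (fun x => Real.exp (w x / C) * ‖fderiv ℝ w x‖ ^ 2) μ := by
    refine (hint t ht).mul_bdd (c := (K : ℝ) ^ 2)
      ((measurable_fderiv ℝ w).norm.pow_const 2).aestronglyMeasurable
      (Eventually.of_forall fun x => ?_)
    rw [norm_pow, norm_norm]
    exact pow_le_pow_left₀ (norm_nonneg _) (norm_fderiv_le_of_lipschitz ℝ hK) 2
  have h1 : ∫ x, Real.exp (w x / C) * (C⁻¹ ^ 2 * ‖fderiv ℝ w x‖ ^ 2) ∂μ =
      C⁻¹ ^ 2 * ∫ x, Real.exp (w x / C) * ‖fderiv ℝ w x‖ ^ 2 ∂μ := by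
    rw [← integral_const_mul]; congr 1; funext x; ring
  have h2 : ∫ x, Real.exp (w x / C) * ((w x - ‖fderiv ℝ w x‖ ^ 2 / 2) / (t * C)) ∂μ =
      (∫ x, Real.exp (w x / C) * w x ∂μ -
        (∫ x, Real.exp (w x / C) * ‖fderiv ℝ w x‖ ^ 2 ∂μ) / 2) / (t * C) := by
    rw [← integral_div, ← integral_sub hi1 (hi2.div_const 2), ← integral_div]
    congr 1; funext x; ring
  have h3 : ∫ x, Real.exp (w x / C) * ((w x - ‖fderiv ℝ w x‖ ^ 2 / 2) / (t * C)) ∂μ < r := by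
    refine lt_of_le_of_lt ?_ hr
    rw [h2, div_le_iff₀ (by positivity)]
    rw [h1] at hdual
    have h4 : C ^ 2 / 2 * (C⁻¹ ^ 2 * ∫ x, Real.exp (w x / C) * ‖fderiv ℝ w x‖ ^ 2 ∂μ) =
        (∫ x, Real.exp (w x / C) * ‖fderiv ℝ w x‖ ^ 2 ∂μ) / 2 := by field_simp
    have h5 : (∫ y, g y ∂μ) / C * (∫ x, Real.exp (w x / C) ∂μ) * (t * C) =
        (∫ x, Real.exp (w x / C) ∂μ) * (t * ∫ y, g y ∂μ) := by field_simp
    rw [h4] at hdual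
    rw [h5]
    linarith
  have hsub : Tendsto (fun z => z - t) (𝓝[>] t) (𝓝[>] 0) := by
    refine tendsto_nhdsWithin_iff.2 ⟨?_, ?_⟩
    · have : Tendsto (fun z => z - t) (𝓝 t) (𝓝 (t - t)) := tendsto_id.sub_const t
      rw [sub_self] at this
      exact this.mono_left nhdsWithin_le_nhds
    · filter_upwards [self_mem_nhdsWithin] with z (hz : t < z) using sub_pos.2 hz
  have hIoc : ∀ᶠ s : ℝ in 𝓝[>] 0, s ∈ Ioc (0 : ℝ) 1 := Ioc_mem_nhdsGT one_pos
  filter_upwards [hsub.eventually hIoc, hsub.eventually (hlim.eventually_lt_const h3)] with z hz hz'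
  refine lt_of_le_of_lt ?_ hz'
  have hz0 : 0 < z := by linarith [hz.1]
  rw [← integral_sub (hint z hz0) (hint t ht), ← integral_const_mul]
  refine integral_mono (((hint z hz0).sub (hint t ht)).const_mul _) (hb _ hz).1 fun x => ?_
  have := (hb _ hz).2 x
  rwa [add_sub_cancel] at this

lemma continuousOn_integral_exp [IsProbabilityMeasure μ] (hC : 0 < C) (hM : ∀ y, |g y| ≤ M) :
    ContinuousOn (fun t => ∫ x, Real.exp (scaledInfConv g t x / C) ∂μ) (Icc 0 1) := by
  have hM0 : 0 ≤ M := (abs_nonneg _).trans (hM 0)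
  refine continuousOn_of_dominated (bound := fun _ => Real.exp (M / C)) (fun t ht => ?_)
    (fun t ht => Eventually.of_forall fun x => ?_) (integrable_const _)
    (Eventually.of_forall fun x => ?_)
  · obtain ⟨K, hK⟩ := scaledInfConv.exists_lipschitzWith hM ht.1
    exact (hK.continuous.div_const C).rexp.aestronglyMeasurable
  · rw [Real.norm_eq_abs, Real.abs_exp]
    refine Real.exp_le_exp.2 (div_le_div_of_nonneg_right ?_ hC.le)
    have := (abs_le.1 (scaledInfConv.abs_le_mul hM ht.1 x)).2
    nlinarith [ht.2]
  · exact (((scaledInfConv.continuousOn_time hM x).mono Icc_subset_Ici_self).div_const C).rexp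

end Evolution

/-- Under **W₂I(C)**, for every bounded `C¹` function `g`,
`∫ e^{Q₁g/C} dμ ≤ e^{μ(g)/C}`, where `Q₁g(x) = inf_y (g(y) + |x−y|²/2)`. -/
theorem W2I_implies_infConvolution_bound {n : ℕ}
    (V : EuclideanSpace ℝ (Fin n) → ℝ) (hV : ContDiff ℝ 1 V) (Z : ℝ) (hZ : 0 < Z)
    (μ : Measure (EuclideanSpace ℝ (Fin n)))
    (hμ : μ = volume.withDensity fun x => ENNReal.ofReal (Real.exp (-V x) / Z))
    (hμprob : IsProbabilityMeasure μ)
    (C : ℝ) (hC : 0 < C)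
    (hW2I : ∀ ν : Measure (EuclideanSpace ℝ (Fin n)), IsProbabilityMeasure ν →
      wassersteinDist 2 ν μ ^ 2 ≤ ENNReal.ofReal (4 * C ^ 2) * fisherInfo ν μ) :
    ∀ g : EuclideanSpace ℝ (Fin n) → ℝ, ContDiff ℝ 1 g → (∃ M, ∀ x, |g x| ≤ M) →
      ∫ x, Real.exp ((⨅ y, g y + ‖x - y‖ ^ 2 / 2) / C) ∂μ ≤
        Real.exp ((∫ y, g y ∂μ) / C) := by
  intro g hg ⟨M, hM⟩
  have hac : μ ≪ volume := hμ ▸ withDensity_absolutelyContinuous _ _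
  set G : ℝ → ℝ := fun t => ∫ x, Real.exp (scaledInfConv g t x / C) ∂μ with hG
  set a := (∫ y, g y ∂μ) / C with ha
  have hcont : ContinuousOn G (Icc 0 1) := continuousOn_integral_exp hC hM
  have hgron : ∀ δ ∈ Ioo (0 : ℝ) 1, G 1 ≤ G δ * Real.exp (a * (1 - δ)) := by
    intro δ hδ
    have h := le_gronwallBound_of_liminf_deriv_right_le (f := G) (f' := fun t => a * G t)
      (δ := G δ) (K := a) (ε := 0) (a := δ) (b := 1)
      (hcont.mono (Icc_subset_Icc_left hδ.1.le))
      (fun t ht r hr => (eventually_slope_integral_exp_lt hac hC hW2I hg.continuous hM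
        (hδ.1.trans_le ht.1) hr).frequently)
      le_rfl (fun t _ => (add_zero _).ge) 1 (right_mem_Icc.2 hδ.2.le)
    rwa [gronwallBound_ε0] at h
  have hG0 : G 0 = 1 := by
    have h0 : ∀ x, scaledInfConv g 0 x = 0 := fun x => by
      have := scaledInfConv.abs_le_mul hM le_rfl x
      rwa [zero_mul, abs_nonpos_iff] at this
    simp [hG, h0]
  have hlim : Tendsto (fun δ => G δ * Real.exp (a * (1 - δ))) (𝓝[>] 0) (𝓝 (Real.exp a)) := by
    have h1 : Tendsto G (𝓝[>] 0) (𝓝 1) := by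
      rw [← hG0]
      refine (hcont 0 (left_mem_Icc.2 zero_le_one)).mono_left ?_
      rw [← nhdsWithin_Ioo_eq_nhdsGT (zero_lt_one' ℝ)]
      exact nhdsWithin_mono _ Ioo_subset_Icc_self
    have h2 : Tendsto (fun δ : ℝ => Real.exp (a * (1 - δ))) (𝓝[>] 0) (𝓝 (Real.exp a)) := by
      have : Continuous fun δ : ℝ => Real.exp (a * (1 - δ)) := by fun_prop
      simpa using (this.tendsto 0).mono_left nhdsWithin_le_nhds
    simpa using h1.mul h2
  have hfinal : G 1 ≤ Real.exp a := by
    refine ge_of_tendsto hlim ?_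
    filter_upwards [Ioo_mem_nhdsGT (zero_lt_one' ℝ)] with δ hδ using hgron δ hδ
  simpa only [hG, scaledInfConv, one_mul] using hfinal
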